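/- Let k ≥ 0 and n̄ = (n_1,…,n_r) with 1 = n_1 = ⋯ = n_s < n_{s+1} ≤ ⋯ ≤ n_r, and let t ∈ {s,…,r} be maximal such that 3s + Σ_{i=s+1}^t (n_i + 1) ≤ 2k + 2r. Then there exists a (k,n̄)-PPSN polytope of dimension at most: 2(k+r) − s − t if 3s ≤ 2k+2r; 2(k+r−s)+1 if 3s = 2k+2r+1; and 2(k+r−s+1) if 3s ≥ 2k+2r+2. In particular δ_pr(k,n̄), the smallest dimension of a (k,n̄)-PPSN polytope, is bounded above by the corresponding quantity. -/

import Mathlib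

open Set

section PolytopeDefs

variable {E : Type*} [AddCommGroup E] [Module ℝ E]
variable {E' : Type*} [AddCommGroup E'] [Module ℝ E']

/-- A polytope: the convex hull of a finite set of points. -/
def IsPolytope (P : Set E) : Prop :=
  ∃ V : Finset E, P = convexHull ℝ (V : Set E)

/-- The dimension of a set of points: the dimension of its affine span. -/
noncomputable def polyDim (P : Set E) : ℕ :=
  Module.finrank ℝ (affineSpan ℝ P).direction

/-- A nonempty exposed face of `P`: a nonempty set of the form
`{x ∈ P | ⟨c,x⟩ = max_{y ∈ P} ⟨c,y⟩}` for a linear functional `c`. -/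
def IsFace (P F : Set E) : Prop :=
  F.Nonempty ∧ ∃ c : E →ₗ[ℝ] ℝ, F = {x ∈ P | ∀ y ∈ P, c y ≤ c x}

/-- The `k`-skeleton of `P`: its nonempty faces of dimension at most `k`. -/
def skel (k : ℕ) (P : Set E) : Set (Set E) :=
  {F | IsFace P F ∧ polyDim F ≤ k}

/-- The set of all nonempty faces of `P`. -/
def facesOf (P : Set E) : Set (Set E) :=
  {F | IsFace P F}

/-- Combinatorial equivalence of `k`-skeletons: the posets of faces of dimension
at most `k`, ordered by inclusion, are order-isomorphic. -/
def SkelEquiv (k : ℕ) (P : Set E) (Q : Set E') : Prop :=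
  Nonempty (skel k P ≃o skel k Q)

end PolytopeDefs

/-- The product of standard simplices `Δ_{n 0} × ⋯ × Δ_{n (r-1)}`. -/
def prodSimplex {r : ℕ} (n : Fin r → ℕ) : Set ((i : Fin r) → Fin (n i + 1) → ℝ) :=
  Set.univ.pi fun i => stdSimplex ℝ (Fin (n i + 1))

/-- `P` is `(k, n̄)`-prodsimplicial-neighborly: it is a polytope whose `k`-skeleton
is combinatorially equivalent to that of the product of simplices `Δ_n̄`. -/
def IsPSN {E : Type*} [AddCommGroup E] [Module ℝ E] (k : ℕ) {r : ℕ} (n : Fin r → ℕ)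
    (P : Set E) : Prop :=
  IsPolytope P ∧ SkelEquiv k P (prodSimplex n)

/-- `P` is `(k, n̄)`-projected-prodsimplicial-neighborly: it is `(k, n̄)`-PSN and moreover
the image under a linear map of a polytope whose poset of all nonempty faces is
order-isomorphic to that of `Δ_n̄`. -/
def IsPPSN {E : Type*} [AddCommGroup E] [Module ℝ E] (k : ℕ) {r : ℕ} (n : Fin r → ℕ)
    (P : Set E) : Prop :=
  IsPSN k n P ∧ ∃ (N : ℕ) (Q : Set (Fin N → ℝ)) (f : (Fin N → ℝ) →ₗ[ℝ] E),
    IsPolytope Q ∧ P = f '' Q ∧ Nonempty (facesOf Q ≃o facesOf (prodSimplex n))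

section ExposedSets

variable {V E E' : Type*} [AddCommGroup E] [Module ℝ E] [AddCommGroup E'] [Module ℝ E']

/-- The indices at which a linear functional is maximal on a family of points. -/
def argmaxSet (w : V → E) (c : E →ₗ[ℝ] ℝ) : Set V :=
  {v | ∀ v', c (w v') ≤ c (w v)}

/-- The index sets of the points of a family that lie on a common exposed face. -/
def exposedSets (w : V → E) : Set (Set V) :=
  Set.range (argmaxSet w)

lemma argmaxSet_nonempty [Finite V] [Nonempty V] (w : V → E) (c : E →ₗ[ℝ] ℝ) :
    (argmaxSet w c).Nonempty :=
  Finite.exists_max fun v => c (w v)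

lemma exposedSets_linearMap_comp_subset (f : E →ₗ[ℝ] E') (w : V → E) :
    exposedSets (f ∘ w) ⊆ exposedSets w := by
  rintro _ ⟨c, rfl⟩
  exact ⟨c ∘ₗ f, rfl⟩

lemma le_of_mem_convexHull_range {w : V → E} {c : E →ₗ[ℝ] ℝ} {m : ℝ} (h : ∀ v, c (w v) ≤ m)
    {x : E} (hx : x ∈ convexHull ℝ (range w)) : c x ≤ m := by
  have : convexHull ℝ (range w) ⊆ {y | c y ≤ m} :=
    convexHull_min (by rintro _ ⟨v, rfl⟩; exact h v) (convex_halfSpace_le c.isLinear m)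
  exact this hx

lemma apply_eq_of_mem_convexHull_image {w : V → E} {c : E →ₗ[ℝ] ℝ} {S : Set V} {m : ℝ}
    (h : ∀ v ∈ S, c (w v) = m) {x : E} (hx : x ∈ convexHull ℝ (w '' S)) : c x = m := by
  have : convexHull ℝ (w '' S) ⊆ {y | c y = m} :=
    convexHull_min (by rintro _ ⟨v, hv, rfl⟩; exact h v hv) (convex_hyperplane c.isLinear m)
  exact this hx

lemma maximizers_convexHull_range [Finite V] [Nonempty V] (w : V → E) (c : E →ₗ[ℝ] ℝ) :
    {x ∈ convexHull ℝ (range w) | ∀ y ∈ convexHull ℝ (range w), c y ≤ c x} =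
      convexHull ℝ (w '' argmaxSet w c) := by
  obtain ⟨v₀, hv₀⟩ := argmaxSet_nonempty w c
  have hS : ∀ v ∈ argmaxSet w c, c (w v) = c (w v₀) := fun v hv => le_antisymm (hv₀ v) (hv v₀)
  apply Subset.antisymm
  · rintro x ⟨hx, hmax⟩
    have hxm : c (w v₀) ≤ c x := hmax _ (subset_convexHull ℝ _ ⟨v₀, rfl⟩)
    rcases (argmaxSet w c)ᶜ.eq_empty_or_nonempty with he | hne
    · rw [compl_empty_iff] at he
      rwa [he, image_univ]
    · rw [← image_univ, ← union_compl_self (argmaxSet w c), image_union,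
        convexHull_union (Set.Nonempty.image _ ⟨v₀, hv₀⟩) (hne.image _), mem_convexJoin] at hx
      obtain ⟨p, hp, q, hq, a, b, ha, hb, hab, rfl⟩ := hx
      have hcp := apply_eq_of_mem_convexHull_image hS hp
      have hcq : c q < c (w v₀) := by
        have : convexHull ℝ (w '' (argmaxSet w c)ᶜ) ⊆ {y | c y < c (w v₀)} := by
          refine convexHull_min ?_ (convex_halfSpace_lt c.isLinear _)
          rintro _ ⟨v, hv, rfl⟩
          by_contra hcon
          exact hv fun v' => (hv₀ v').trans (not_lt.mp hcon)
        exact this hq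
      simp only [map_add, map_smul, smul_eq_mul, hcp] at hxm
      have hb0 : b = 0 := by
        by_contra hb0
        have : 0 < b := lt_of_le_of_ne hb (Ne.symm hb0)
        have ha' : a = 1 - b := by linarith
        subst ha'
        nlinarith
      have ha1 : a = 1 := by linarith
      simpa [hb0, ha1] using hp
  · intro x hx
    refine ⟨convexHull_mono (image_subset_range _ _) hx, fun y hy => ?_⟩
    rw [apply_eq_of_mem_convexHull_image hS hx]
    exact le_of_mem_convexHull_range hv₀ hy

lemma isFace_convexHull_range_iff [Finite V] [Nonempty V] {w : V → E} {F : Set E} :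
    IsFace (convexHull ℝ (range w)) F ↔ ∃ S ∈ exposedSets w, F = convexHull ℝ (w '' S) := by
  constructor
  · rintro ⟨-, c, rfl⟩
    exact ⟨_, ⟨c, rfl⟩, maximizers_convexHull_range w c⟩
  · rintro ⟨_, ⟨c, rfl⟩, rfl⟩
    exact ⟨((argmaxSet_nonempty w c).image _).convexHull, c, (maximizers_convexHull_range w c).symm⟩

lemma preimage_convexHull_image [Finite V] [Nonempty V] {w : V → E} {S : Set V}
    (hS : S ∈ exposedSets w) : w ⁻¹' convexHull ℝ (w '' S) = S := by
  obtain ⟨c, rfl⟩ := hS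
  refine Subset.antisymm (fun v hv v' => ?_) fun v hv => subset_convexHull ℝ _ ⟨v, hv, rfl⟩
  rw [mem_preimage, ← maximizers_convexHull_range] at hv
  exact hv.2 _ (subset_convexHull ℝ _ ⟨v', rfl⟩)

/-- A family of faces of the convex hull of finitely many points is isomorphic, as a poset, to
the family of the index sets of the points on these faces. -/
lemma nonempty_orderIso_of_faces [Finite V] [Nonempty V] {w : V → E} {𝔉 : Set (Set E)}
    {𝔖 : Set (Set V)} (h : 𝔉 = (fun S => convexHull ℝ (w '' S)) '' 𝔖)
    (h𝔖 : 𝔖 ⊆ exposedSets w) : Nonempty (𝔖 ≃o 𝔉) := by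
  subst h
  have hinj : ∀ S ∈ 𝔖, ∀ S' ∈ 𝔖,
      convexHull ℝ (w '' S) ⊆ convexHull ℝ (w '' S') ↔ S ⊆ S' := fun S hS S' hS' => by
    refine ⟨fun hSS' => ?_, fun hSS' => convexHull_mono (image_mono hSS')⟩
    have := preimage_mono (f := w) hSS'
    rwa [preimage_convexHull_image (h𝔖 hS), preimage_convexHull_image (h𝔖 hS')] at this
  refine ⟨⟨Equiv.ofBijective (fun S => ⟨_, mem_image_of_mem _ S.2⟩) ⟨?_, ?_⟩, ?_⟩⟩
  · rintro ⟨S, hS⟩ ⟨S', hS'⟩ heq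
    have heq' : convexHull ℝ (w '' S) = convexHull ℝ (w '' S') := congrArg Subtype.val heq
    exact Subtype.ext (Subset.antisymm ((hinj S hS S' hS').1 heq'.subset)
      ((hinj S' hS' S hS).1 heq'.superset))
  · rintro ⟨_, S, hS, rfl⟩
    exact ⟨⟨S, hS⟩, rfl⟩
  · rintro ⟨S, hS⟩ ⟨S', hS'⟩
    exact hinj S hS S' hS'

lemma facesOf_convexHull_range [Finite V] [Nonempty V] (w : V → E) :
    facesOf (convexHull ℝ (range w)) = (fun S => convexHull ℝ (w '' S)) '' exposedSets w := by
  ext F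
  exact isFace_convexHull_range_iff.trans (by simp only [mem_image, eq_comm])

lemma nonempty_facesOf_orderIso [Finite V] [Nonempty V] {w : V → E} {w' : V → E'}
    (h : exposedSets w = exposedSets w') :
    Nonempty (facesOf (convexHull ℝ (range w)) ≃o facesOf (convexHull ℝ (range w'))) := by
  obtain ⟨e⟩ := nonempty_orderIso_of_faces (facesOf_convexHull_range w) subset_rfl
  obtain ⟨e'⟩ := nonempty_orderIso_of_faces (facesOf_convexHull_range w') subset_rfl
  rw [← h] at e'
  exact ⟨e.symm.trans e'⟩

lemma polyDim_convexHull (s : Set E) :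
    polyDim (convexHull ℝ s) = Module.finrank ℝ (vectorSpan ℝ s) := by
  rw [polyDim, affineSpan_convexHull, direction_affineSpan]

lemma polyDim_convexHull_image_lt [Finite V] [Nonempty V] [FiniteDimensional ℝ E] {w : V → E}
    {S S' : Set V} (hS : S ∈ exposedSets w) (hSS' : S ⊂ S') :
    polyDim (convexHull ℝ (w '' S)) < polyDim (convexHull ℝ (w '' S')) := by
  obtain ⟨c, rfl⟩ := hS
  obtain ⟨v₀, hv₀⟩ := argmaxSet_nonempty w c
  obtain ⟨v, hv, hvS⟩ := exists_of_ssubset hSS'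
  rw [polyDim_convexHull, polyDim_convexHull]
  apply Submodule.finrank_lt_finrank_of_lt
  refine lt_of_le_of_ne (vectorSpan_mono _ (image_mono hSS'.1)) fun heq => hvS fun v' => ?_
  have hker : vectorSpan ℝ (w '' argmaxSet w c) ≤ LinearMap.ker c := by
    rw [vectorSpan_def, Submodule.span_le]
    rintro _ ⟨_, ⟨a, ha, rfl⟩, _, ⟨b, hb, rfl⟩, rfl⟩
    simp [le_antisymm (hb a) (ha b)]
  have : w v - w v₀ ∈ LinearMap.ker c := hker <| heq ▸
    vsub_mem_vectorSpan ℝ (mem_image_of_mem w hv) (mem_image_of_mem w (hSS'.1 hv₀))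
  rw [LinearMap.mem_ker, map_sub, sub_eq_zero] at this
  exact this ▸ hv₀ v'

lemma polyDim_image_le [FiniteDimensional ℝ E] (f : E →ₗ[ℝ] E') (P : Set E) :
    polyDim (f '' P) ≤ polyDim P := by
  have h := AffineMap.map_vectorSpan (k := ℝ) f.toAffineMap (s := P)
  have h' : vectorSpan ℝ (f '' P) = (vectorSpan ℝ P).map f := by simpa using h.symm
  rw [polyDim, polyDim, direction_affineSpan, direction_affineSpan, h']
  exact Submodule.finrank_map_le f _

end ExposedSets

section ProductFaces

variable {ι : Type*} [Fintype ι] [DecidableEq ι] {α : ι → Type*}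

/-- The dimension of the face of a product of simplices whose vertices are the choices of one
vertex from each of the sets `T i`. -/
def prodDim (T : (i : ι) → Finset (α i)) : ℕ :=
  ∑ i, ((T i).card - 1)

/-- The vertices of a face of a product of simplices. -/
def prodSet (T : (i : ι) → Finset (α i)) : Set ((i : ι) → α i) :=
  {v | ∀ i, v i ∈ T i}

/-- The vertex sets of the nonempty faces of a product of simplices. -/
def prodSets (α : ι → Type*) : Set (Set ((i : ι) → α i)) :=
  {S | ∃ T : (i : ι) → Finset (α i), (∀ i, (T i).Nonempty) ∧ S = prodSet T}

/-- The vertex sets of the nonempty faces of dimension at most `k` of a product of simplices. -/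
def smallProdSets (α : ι → Type*) (k : ℕ) : Set (Set ((i : ι) → α i)) :=
  {S | ∃ T : (i : ι) → Finset (α i), (∀ i, (T i).Nonempty) ∧ prodDim T ≤ k ∧ S = prodSet T}

lemma smallProdSets_subset (k : ℕ) : smallProdSets α k ⊆ prodSets α := by
  rintro S ⟨T, hT, -, rfl⟩
  exact ⟨T, hT, rfl⟩

variable [∀ i, DecidableEq (α i)]

omit [Fintype ι] [∀ i, DecidableEq (α i)] in
lemma prodSet_subset_prodSet {T T' : (i : ι) → Finset (α i)} (hT : ∀ i, (T i).Nonempty) :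
    prodSet T ⊆ prodSet T' ↔ ∀ i, T i ⊆ T' i := by
  refine ⟨fun h i a ha => ?_, fun h v hv i => h i (hv i)⟩
  choose v hv using hT
  have := h (show Function.update v i a ∈ prodSet T from fun j => by
    by_cases hj : j = i
    · subst hj; simpa
    · simpa [hj] using hv j) i
  simpa using this

lemma prodDim_update (T : (i : ι) → Finset (α i)) (i : ι) (s : Finset (α i)) :
    prodDim (Function.update T i s) + ((T i).card - 1) = prodDim T + (s.card - 1) := by
  simp only [prodDim]
  rw [← Finset.add_sum_erase _ _ (Finset.mem_univ i), ← Finset.add_sum_erase _ _ (Finset.mem_univ i)]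
  rw [Finset.sum_congr rfl (g := fun j => (T j).card - 1) fun j hj => by
    rw [Function.update_of_ne (Finset.ne_of_mem_erase hj)]]
  simp only [Function.update_self]
  ring

lemma exists_prodSet_ssubset {T : (i : ι) → Finset (α i)} (hT : ∀ i, (T i).Nonempty) {m : ℕ}
    (hm : prodDim T = m + 1) : ∃ T' : (i : ι) → Finset (α i), (∀ i, (T' i).Nonempty) ∧
      prodSet T' ⊂ prodSet T ∧ prodDim T' = m := by
  obtain ⟨i, hi⟩ : ∃ i, 2 ≤ (T i).card := by
    by_contra! h
    have : prodDim T = 0 := Finset.sum_eq_zero fun i _ => by have := h i; omega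
    omega
  obtain ⟨a, ha⟩ := hT i
  have hcard := Finset.card_erase_of_mem ha
  have hT' : ∀ j, (Function.update T i ((T i).erase a) j).Nonempty := fun j => by
    by_cases hj : j = i
    · subst hj
      rw [Function.update_self, ← Finset.card_pos]
      omega
    · rw [Function.update_of_ne hj]
      exact hT j
  refine ⟨_, hT', ⟨(prodSet_subset_prodSet hT').2 fun j => ?_, fun h => ?_⟩, ?_⟩
  · by_cases hj : j = i
    · subst hj
      simpa using Finset.erase_subset a (T j)
    · rw [Function.update_of_ne hj]
  · have := (prodSet_subset_prodSet hT).1 h i ha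
    simp at this
  · have := prodDim_update T i ((T i).erase a)
    omega

lemma exists_ssubset_prodSet {T : (i : ι) → Finset (α i)} (hT : ∀ i, (T i).Nonempty) {i : ι}
    {a : α i} (ha : a ∉ T i) : ∃ T' : (i : ι) → Finset (α i), (∀ i, (T' i).Nonempty) ∧
      prodSet T ⊂ prodSet T' ∧ prodDim T' = prodDim T + 1 := by
  have hcard := Finset.card_insert_of_notMem ha
  have hT' : ∀ j, (Function.update T i (insert a (T i)) j).Nonempty := fun j => by
    by_cases hj : j = i
    · subst hj
      simp
    · rw [Function.update_of_ne hj]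
      exact hT j
  refine ⟨_, hT', ⟨(prodSet_subset_prodSet hT).2 fun j => ?_, fun h => ?_⟩, ?_⟩
  · by_cases hj : j = i
    · subst hj
      simp
    · rw [Function.update_of_ne hj]
  · refine ha ((prodSet_subset_prodSet hT').1 h i ?_)
    simp
  · have := prodDim_update T i (insert a (T i))
    have := Finset.card_pos.2 (hT i)
    omega

variable [∀ i, Fintype (α i)] {E E' : Type*} [AddCommGroup E] [Module ℝ E]
  [FiniteDimensional ℝ E] [AddCommGroup E'] [Module ℝ E'] [FiniteDimensional ℝ E']

lemma prodDim_le (T : (i : ι) → Finset (α i)) : prodDim T ≤ ∑ i, (Fintype.card (α i) - 1) :=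
  Finset.sum_le_sum fun i _ => Nat.sub_le_sub_right (Finset.card_le_univ (T i)) 1

variable [∀ i, Nonempty (α i)]

lemma polyDim_prodSet_le {x : ((i : ι) → α i) → E} (hx : prodSets α ⊆ exposedSets x)
    (hdim : polyDim (convexHull ℝ (range x)) ≤ ∑ i, (Fintype.card (α i) - 1))
    (T : (i : ι) → Finset (α i)) (hT : ∀ i, (T i).Nonempty) :
    polyDim (convexHull ℝ (x '' prodSet T)) ≤ prodDim T := by
  by_cases huniv : ∀ i a, a ∈ T i
  · have h1 : prodSet T = univ := eq_univ_of_forall fun v i => huniv i _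
    have h2 : prodDim T = ∑ i, (Fintype.card (α i) - 1) :=
      Finset.sum_congr rfl fun i _ => by rw [Finset.eq_univ_of_forall (huniv i), Finset.card_univ]
    rwa [h1, h2, image_univ]
  · push Not at huniv
    obtain ⟨i, a, ha⟩ := huniv
    obtain ⟨T', hT', hsub, hdimT'⟩ := exists_ssubset_prodSet hT ha
    have hle := prodDim_le T'
    have ih := polyDim_prodSet_le hx hdim T' hT'
    have := polyDim_convexHull_image_lt (hx ⟨T, hT, rfl⟩) hsub
    omega
termination_by ∑ i, (Fintype.card (α i) - 1) - prodDim T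

lemma min_prodDim_le_polyDim {w : ((i : ι) → α i) → E} {k : ℕ}
    (hw : smallProdSets α k ⊆ exposedSets w) (T : (i : ι) → Finset (α i))
    (hT : ∀ i, (T i).Nonempty) :
    min (prodDim T) (k + 1) ≤ polyDim (convexHull ℝ (w '' prodSet T)) := by
  induction h : prodDim T generalizing T with
  | zero => simp
  | succ m ih =>
    obtain ⟨T', hT', hsub, hdimT'⟩ := exists_prodSet_ssubset hT h
    have ih := ih T' hT' hdimT'
    by_cases hmk : m ≤ k
    · have := polyDim_convexHull_image_lt (hw ⟨T', hT', hdimT' ▸ hmk, rfl⟩) hsub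
      omega
    · have : polyDim (convexHull ℝ (w '' prodSet T')) ≤ polyDim (convexHull ℝ (w '' prodSet T)) := by
        rw [polyDim_convexHull, polyDim_convexHull]
        exact Submodule.finrank_mono (vectorSpan_mono _ (image_mono hsub.1))
      omega

lemma skel_convexHull_range {w : ((i : ι) → α i) → E} {k : ℕ} (hw : exposedSets w ⊆ prodSets α)
    (hk : smallProdSets α k ⊆ exposedSets w)
    (hdim : ∀ T : (i : ι) → Finset (α i), (∀ i, (T i).Nonempty) →
      polyDim (convexHull ℝ (w '' prodSet T)) ≤ prodDim T) :
    skel k (convexHull ℝ (range w)) =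
      (fun S => convexHull ℝ (w '' S)) '' smallProdSets α k := by
  ext F
  constructor
  · rintro ⟨hF, hFk⟩
    obtain ⟨S, hS, rfl⟩ := isFace_convexHull_range_iff.1 hF
    obtain ⟨T, hT, rfl⟩ := hw hS
    have := min_prodDim_le_polyDim hk T hT
    exact ⟨_, ⟨T, hT, by omega, rfl⟩, rfl⟩
  · rintro ⟨_, ⟨T, hT, hTk, rfl⟩, rfl⟩
    exact ⟨isFace_convexHull_range_iff.2 ⟨_, hk ⟨T, hT, hTk, rfl⟩, rfl⟩, (hdim T hT).trans hTk⟩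

/-- If all small faces of a polytope with the combinatorics of a product of simplices are
preserved by a linear map, then so is its `k`-skeleton. -/
lemma skelEquiv_of_smallProdSets_subset {x y : ((i : ι) → α i) → E} {f : E →ₗ[ℝ] E'} {k : ℕ}
    (hx : exposedSets x = prodSets α) (hy : exposedSets y = prodSets α)
    (hxdim : polyDim (convexHull ℝ (range x)) ≤ ∑ i, (Fintype.card (α i) - 1))
    (hydim : polyDim (convexHull ℝ (range y)) ≤ ∑ i, (Fintype.card (α i) - 1))
    (hk : smallProdSets α k ⊆ exposedSets (f ∘ x)) :
    SkelEquiv k (convexHull ℝ (range (f ∘ x))) (convexHull ℝ (range y)) := by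
  have h1 := skel_convexHull_range ((exposedSets_linearMap_comp_subset f x).trans hx.subset) hk
    fun T hT => by
      rw [image_comp, ← f.image_convexHull]
      exact (polyDim_image_le f _).trans (polyDim_prodSet_le hx.superset hxdim T hT)
  have hky : smallProdSets α k ⊆ exposedSets y := (smallProdSets_subset k).trans hy.superset
  have h2 := skel_convexHull_range hy.subset hky (polyDim_prodSet_le hy.superset hydim)
  obtain ⟨e₁⟩ := nonempty_orderIso_of_faces h1 hk
  obtain ⟨e₂⟩ := nonempty_orderIso_of_faces h2 hky
  exact ⟨e₁.symm.trans e₂⟩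

end ProductFaces

lemma exists_fixed_of_wellFounded {ι β : Type*} [Nonempty β] {lt : ι → ι → Prop}
    (wf : WellFounded lt) (F : ι → (ι → β) → β)
    (hF : ∀ i f g, (∀ j, lt j i → f j = g j) → F i f = F i g) : ∃ f : ι → β, ∀ i, f i = F i f := by
  classical
  let b : β := Classical.arbitrary β
  refine ⟨wf.fix fun i rec => F i fun j => if h : lt j i then rec j h else b, fun i => ?_⟩
  rw [wf.fix_eq]
  exact hF _ _ _ fun j hj => by rw [dif_pos hj]

section DeformedProducts

variable {ι : Type*} [Fintype ι] [LinearOrder ι] {α : ι → Type*} [∀ i, DecidableEq (α i)]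

/-- The vertices of a product of simplices, the `i`-th of which is rescaled by `ρ i`. -/
def deformedVertex (ρ : ι → ((i : ι) → α i) → ℝ) (v : (i : ι) → α i) : (i : ι) → α i → ℝ :=
  fun i => Pi.single (v i) (ρ i v)

/-- A system of positive scaling factors, the `i`-th of which is an affine function of the
coordinates with larger indices, with linear part `γ i`. -/
def IsScaling (γ : ι → (j : ι) → α j → ℝ) (H : ι → ℝ) (ρ : ι → ((i : ι) → α i) → ℝ) : Prop :=
  ∀ i v, 0 < ρ i v ∧ ρ i v = H i + ∑ j with i < j, ρ j v * γ i j (v j)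

/-- The slacks of the facet inequalities of a deformed product at the functional `c`, in terms of
the maxima `M` over the single factors. -/
def slack (γ : ι → (j : ι) → α j → ℝ) (M : ι → ℝ) (c : (i : ι) → α i → ℝ) (j : ι) (a : α j) : ℝ :=
  M j - c j a - ∑ i with i < j, M i * γ i j a

omit [∀ i, DecidableEq (α i)] in
lemma sum_mul_scaling_eq {γ : ι → (j : ι) → α j → ℝ} {H : ι → ℝ} {ρ : ι → ((i : ι) → α i) → ℝ}
    (hρ : IsScaling γ H ρ) (M : ι → ℝ) (c : (i : ι) → α i → ℝ) (v : (i : ι) → α i) :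
    ∑ j, c j (v j) * ρ j v = ∑ j, M j * H j - ∑ j, ρ j v * slack γ M c j (v j) := by
  have h1 : ∑ j, M j * ρ j v = ∑ j, M j * H j +
      ∑ j, ρ j v * ∑ i with i < j, M i * γ i j (v j) := by
    calc ∑ j, M j * ρ j v
        = ∑ i, (M i * H i + ∑ j with i < j, M i * (ρ j v * γ i j (v j))) := by
          refine Finset.sum_congr rfl fun i _ => ?_
          rw [← Finset.mul_sum, ← mul_add, ← (hρ i v).2]
      _ = _ := by
          rw [Finset.sum_add_distrib]
          congr 1
          simp only [Finset.mul_sum, Finset.sum_filter]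
          rw [Finset.sum_comm]
          refine Finset.sum_congr rfl fun j _ => Finset.sum_congr rfl fun i _ => ?_
          split_ifs <;> ring
  have h2 : ∑ j, ρ j v * slack γ M c j (v j) = ∑ j, M j * ρ j v - ∑ j, c j (v j) * ρ j v -
      ∑ j, ρ j v * ∑ i with i < j, M i * γ i j (v j) := by
    rw [← Finset.sum_sub_distrib, ← Finset.sum_sub_distrib]
    exact Finset.sum_congr rfl fun j _ => by rw [slack]; ring
  linarith

variable [∀ i, Fintype (α i)]

/-- The standard pairing of `∏ i, ℝ ^ (α i)` with itself. -/
def pairing (c : (i : ι) → α i → ℝ) : ((i : ι) → α i → ℝ) →ₗ[ℝ] ℝ where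
  toFun x := ∑ i, ∑ a, c i a * x i a
  map_add' x y := by simp [mul_add, Finset.sum_add_distrib]
  map_smul' t x := by
    simp only [Pi.smul_apply, smul_eq_mul, Finset.mul_sum, RingHom.id_apply]
    refine Finset.sum_congr rfl fun i _ => Finset.sum_congr rfl fun a _ => by ring

lemma pairing_deformedVertex (c : (i : ι) → α i → ℝ) (ρ : ι → ((i : ι) → α i) → ℝ)
    (v : (i : ι) → α i) : pairing c (deformedVertex ρ v) = ∑ j, c j (v j) * ρ j v := by
  refine Finset.sum_congr rfl fun j _ => ?_
  simp [deformedVertex, Pi.single_apply]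

lemma exists_eq_pairing (φ : ((i : ι) → α i → ℝ) →ₗ[ℝ] ℝ) : ∃ c, φ = pairing c := by
  refine ⟨fun i a => φ (Pi.single i (Pi.single a 1)), ?_⟩
  refine LinearMap.pi_ext' fun i => LinearMap.pi_ext' fun a => LinearMap.ext_ring ?_
  simp only [LinearMap.comp_apply, LinearMap.single_apply, pairing, LinearMap.coe_mk,
    AddHom.coe_mk]
  rw [Finset.sum_eq_single i, Finset.sum_eq_single a]
  · simp
  · intro b _ hb
    simp [hb]
  · simp
  · intro j _ hj
    simp [hj]
  · simp

lemma argmaxSet_pairing {γ : ι → (j : ι) → α j → ℝ} {H : ι → ℝ} {ρ : ι → ((i : ι) → α i) → ℝ}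
    (hρ : IsScaling γ H ρ) {M : ι → ℝ} {c : (i : ι) → α i → ℝ} {T : (i : ι) → Finset (α i)}
    (hT : ∀ i, (T i).Nonempty)
    (h : ∀ j a, 0 ≤ slack γ M c j a ∧ (slack γ M c j a = 0 ↔ a ∈ T j)) :
    argmaxSet (deformedVertex ρ) (pairing c) = prodSet T := by
  have key : ∀ v, (∀ j, v j ∈ T j) ↔ ∑ j, ρ j v * slack γ M c j (v j) = 0 := fun v => by
    rw [Finset.sum_eq_zero_iff_of_nonneg fun j _ => mul_nonneg (hρ j v).1.le (h j (v j)).1]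
    refine ⟨fun hv j _ => by rw [(h j _).2.2 (hv j), mul_zero], fun hv j => ?_⟩
    exact (h j _).2.1 ((mul_eq_zero.1 (hv j (Finset.mem_univ j))).resolve_left (hρ j v).1.ne')
  have hnn : ∀ v, 0 ≤ ∑ j, ρ j v * slack γ M c j (v j) := fun v =>
    Finset.sum_nonneg fun j _ => mul_nonneg (hρ j v).1.le (h j (v j)).1
  choose v₀ hv₀ using hT
  have h0 := (key v₀).1 hv₀
  ext v
  simp only [argmaxSet, mem_setOf_eq, prodSet, pairing_deformedVertex,
    sum_mul_scaling_eq hρ M c]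
  rw [key]
  refine ⟨fun hv => ?_, fun hv v' => ?_⟩
  · have := hv v₀
    have := hnn v
    linarith
  · have := hnn v'
    linarith

lemma exists_scaling (γ : ι → (j : ι) → α j → ℝ) : ∃ H ρ, IsScaling γ H ρ := by
  let g : (ι → ((i : ι) → α i) → ℝ) → ι → ((i : ι) → α i) → ℝ := fun ρ i v =>
    ∑ j with i < j, ρ j v * γ i j (v j)
  obtain ⟨ρ, hρ⟩ := exists_fixed_of_wellFounded (wellFounded_gt (α := ι))
    (fun i ρ v => 1 + ∑ v', |g ρ i v'| + g ρ i v) fun i f f' hf => by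
      have : g f i = g f' i := by
        funext v
        exact Finset.sum_congr rfl fun j hj => by rw [hf j (Finset.mem_filter.1 hj).2]
      simp only [this]
  refine ⟨fun i => 1 + ∑ v', |g ρ i v'|, ρ, fun i v => ⟨?_, by rw [hρ i]⟩⟩
  rw [hρ i]
  have h1 := Finset.single_le_sum (f := fun v' => |g ρ i v'|) (fun v' _ => abs_nonneg _)
    (Finset.mem_univ v)
  have h2 := neg_abs_le (g ρ i v)
  simp only at h1 ⊢
  linarith

variable [∀ i, Nonempty (α i)]

omit [∀ i, DecidableEq (α i)] in
lemma exists_slack_nonneg (γ : ι → (j : ι) → α j → ℝ) (c : (i : ι) → α i → ℝ) :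
    ∃ M : ι → ℝ, ∀ j, (∀ a, 0 ≤ slack γ M c j a) ∧ ∃ a, slack γ M c j a = 0 := by
  obtain ⟨M, hM⟩ := exists_fixed_of_wellFounded (wellFounded_lt (α := ι))
    (fun j M => Finset.univ.sup' Finset.univ_nonempty
      fun a => c j a + ∑ i with i < j, M i * γ i j a) fun i f f' hf => by
      congr 1
      funext a
      congr 1
      exact Finset.sum_congr rfl fun j hj => by rw [hf j (Finset.mem_filter.1 hj).2]
  refine ⟨M, fun j => ⟨fun a => ?_, ?_⟩⟩
  · have := Finset.le_sup' (fun a => c j a + ∑ i with i < j, M i * γ i j a) (Finset.mem_univ a)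
    rw [← hM j] at this
    rw [slack]
    linarith
  · obtain ⟨a, -, ha⟩ := Finset.exists_mem_eq_sup' Finset.univ_nonempty
      fun a => c j a + ∑ i with i < j, M i * γ i j a
    refine ⟨a, ?_⟩
    rw [slack, hM j, ha]
    ring

lemma exposedSets_deformedVertex {γ : ι → (j : ι) → α j → ℝ} {H : ι → ℝ}
    {ρ : ι → ((i : ι) → α i) → ℝ} (hρ : IsScaling γ H ρ) :
    exposedSets (deformedVertex ρ) = prodSets α := by
  apply Subset.antisymm
  · rintro _ ⟨φ, rfl⟩
    obtain ⟨c, rfl⟩ := exists_eq_pairing φ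
    obtain ⟨M, hM⟩ := exists_slack_nonneg γ c
    have hT : ∀ j, ({a | slack γ M c j a = 0} : Finset (α j)).Nonempty := fun j => by
      obtain ⟨a, ha⟩ := (hM j).2
      exact ⟨a, by simpa using ha⟩
    exact ⟨_, hT, argmaxSet_pairing hρ hT fun j a => ⟨(hM j).1 a, by simp⟩⟩
  · rintro _ ⟨T, hT, rfl⟩
    refine ⟨_, argmaxSet_pairing hρ (M := 0) (c := fun i a => if a ∈ T i then 0 else -1) hT
      fun j a => ?_⟩
    by_cases ha : a ∈ T j <;> simp [slack, ha]

lemma polyDim_deformedVertex_le {γ : ι → (j : ι) → α j → ℝ} {H : ι → ℝ}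
    {ρ : ι → ((i : ι) → α i) → ℝ} (hρ : IsScaling γ H ρ) :
    polyDim (convexHull ℝ (range (deformedVertex ρ))) ≤ ∑ i, (Fintype.card (α i) - 1) := by
  let a₀ : (i : ι) → α i := fun i => Classical.arbitrary _
  let R : ((i : ι) → α i → ℝ) →ₗ[ℝ] ((i : ι) → {a : α i // a ≠ a₀ i} → ℝ) :=
    LinearMap.pi fun i => LinearMap.pi fun a => LinearMap.proj a.1 ∘ₗ LinearMap.proj i
  have hrel : ∀ y ∈ vectorSpan ℝ (range (deformedVertex ρ)), ∀ i,
      ∑ a, y i a = ∑ j with i < j, ∑ a, y j a * γ i j a := by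
    intro y hy
    rw [vectorSpan_def] at hy
    induction hy using Submodule.span_induction with
    | mem y hy =>
      obtain ⟨_, ⟨v, rfl⟩, _, ⟨v', rfl⟩, rfl⟩ := hy
      intro i
      simp only [vsub_eq_sub, Pi.sub_apply, Finset.sum_sub_distrib, sub_mul]
      simp only [deformedVertex, Pi.single_apply, Finset.sum_ite_eq', ite_mul, zero_mul,
        Finset.mem_univ, if_true]
      rw [(hρ i v).2, (hρ i v').2]
      ring
    | zero => simp
    | add y z _ _ hy hz =>
      intro i
      simp only [Pi.add_apply, Finset.sum_add_distrib, add_mul, hy i, hz i]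
    | smul t y _ hy =>
      intro i
      simp only [Pi.smul_apply, smul_eq_mul, ← Finset.mul_sum, mul_assoc, hy i]
  have hinj : Function.Injective (R.domRestrict (vectorSpan ℝ (range (deformedVertex ρ)))) := by
    rw [← LinearMap.ker_eq_bot, LinearMap.ker_eq_bot']
    rintro ⟨y, hy⟩ hRy
    have hne : ∀ i a, a ≠ a₀ i → y i a = 0 := fun i a ha =>
      congrFun (congrFun hRy i) ⟨a, ha⟩
    have hzero : ∀ i, ∀ a, y i a = 0 := fun i => by
      induction i using (wellFounded_gt (α := ι)).induction with
      | _ i ih =>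
        intro a
        by_cases ha : a = a₀ i
        · have h := hrel y hy i
          rw [Finset.sum_eq_single (a₀ i) (fun b _ hb => hne i b hb) (by simp),
            Finset.sum_eq_zero fun j hj => Finset.sum_eq_zero fun b _ => by
              rw [ih j (Finset.mem_filter.1 hj).2 b, zero_mul]] at h
          rw [ha, h]
        · exact hne i a ha
    exact Subtype.ext (funext fun i => funext fun a => hzero i a)
  rw [polyDim_convexHull]
  refine (LinearMap.finrank_le_finrank_of_injective hinj).trans ?_
  rw [Module.finrank_pi_fintype]
  exact Finset.sum_le_sum fun i _ => by simp [Fintype.card_subtype_compl]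

end DeformedProducts

section PPSN

lemma prodSimplex_eq_convexHull {r : ℕ} (n : Fin r → ℕ) :
    prodSimplex n = convexHull ℝ (range (deformedVertex (α := fun i => Fin (n i + 1)) 1)) := by
  have : range (deformedVertex (α := fun i => Fin (n i + 1)) 1) =
      Set.univ.pi fun i => range fun a : Fin (n i + 1) => (Pi.single a 1 : Fin (n i + 1) → ℝ) := by
    ext x
    simp only [mem_range, mem_pi, mem_univ, true_imp_iff]
    refine ⟨?_, fun h => ?_⟩
    · rintro ⟨v, rfl⟩ i
      exact ⟨v i, rfl⟩
    · choose v hv using h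
      exact ⟨v, funext hv⟩
  rw [this, convexHull_pi, prodSimplex]
  simp only [convexHull_rangle_single_eq_stdSimplex]

/-- A `d`-dimensional space of linear functionals `g` on a deformed product of simplices that
exposes all faces of dimension at most `k` yields a projection of this product that is
`(k, n)`-projected-prodsimplicial-neighborly. -/
theorem exists_isPPSN_of_slack {k r d : ℕ} {n : Fin r → ℕ} {W : Type*} [AddCommGroup W]
    [Module ℝ W] [FiniteDimensional ℝ W] (hW : Module.finrank ℝ W ≤ d)
    (γ : Fin r → (j : Fin r) → Fin (n j + 1) → ℝ)
    (g : W →ₗ[ℝ] ((i : Fin r) → Fin (n i + 1) → ℝ))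
    (h : ∀ T : (i : Fin r) → Finset (Fin (n i + 1)), (∀ i, (T i).Nonempty) → prodDim T ≤ k →
      ∃ (c : W) (M : Fin r → ℝ), ∀ j a,
        0 ≤ slack γ M (g c) j a ∧ (slack γ M (g c) j a = 0 ↔ a ∈ T j)) :
    ∃ P : Set (Fin d → ℝ), IsPPSN k n P ∧ polyDim P ≤ d := by
  obtain ⟨H, ρ, hρ⟩ := exists_scaling γ
  have hone : IsScaling (α := fun i => Fin (n i + 1)) 0 1 1 := fun i v => by simp
  let b := Module.finBasis ℝ W
  let f : ((i : Fin r) → Fin (n i + 1) → ℝ) →ₗ[ℝ] (Fin d → ℝ) :=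
    LinearMap.pi fun l => if hl : (l : ℕ) < Module.finrank ℝ W then pairing (g (b ⟨l, hl⟩)) else 0
  have hf : ∀ c : W, ∃ c' : (Fin d → ℝ) →ₗ[ℝ] ℝ, c' ∘ₗ f = pairing (g c) := fun c => by
    refine ⟨∑ l, b.repr c l • LinearMap.proj (Fin.castLE hW l), LinearMap.ext fun x => ?_⟩
    have hpair : pairing (g c) x = ∑ l, b.repr c l * pairing (g (b l)) x := by
      conv_lhs => rw [← b.sum_repr c]
      simp only [pairing, LinearMap.coe_mk, AddHom.coe_mk, map_sum, map_smul, Finset.sum_apply,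
        Pi.smul_apply, smul_eq_mul, Finset.sum_mul, Finset.mul_sum]
      rw [Finset.sum_congr rfl fun i _ => Finset.sum_comm, Finset.sum_comm]
      simp only [mul_assoc]
    rw [hpair]
    simp [f]
  have hk : smallProdSets (fun i => Fin (n i + 1)) k ⊆ exposedSets (f ∘ deformedVertex ρ) := by
    rintro _ ⟨T, hT, hTk, rfl⟩
    obtain ⟨c, M, hM⟩ := h T hT hTk
    obtain ⟨c', hc'⟩ := hf c
    refine ⟨c', ?_⟩
    rw [← argmaxSet_pairing hρ hT hM, ← hc']
    rfl
  let e := (Module.finBasis ℝ ((i : Fin r) → Fin (n i + 1) → ℝ)).equivFun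
  have hfinite : ∀ {F : Type} [AddCommGroup F] [Module ℝ F]
      (w : ((i : Fin r) → Fin (n i + 1)) → F), IsPolytope (convexHull ℝ (range w)) :=
    fun w => ⟨(finite_range w).toFinset, by simp⟩
  refine ⟨convexHull ℝ (range (f ∘ deformedVertex ρ)), ⟨⟨hfinite _, ?_⟩, _,
    convexHull ℝ (range (e ∘ deformedVertex ρ)), f ∘ₗ e.symm.toLinearMap, hfinite _, ?_, ?_⟩, ?_⟩
  · rw [prodSimplex_eq_convexHull]
    exact skelEquiv_of_smallProdSets_subset (exposedSets_deformedVertex hρ)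
      (exposedSets_deformedVertex hone) (polyDim_deformedVertex_le hρ)
      (polyDim_deformedVertex_le hone) hk
  · rw [LinearMap.image_convexHull, ← range_comp]
    congr 2
    funext v
    simp
  · rw [prodSimplex_eq_convexHull]
    apply nonempty_facesOf_orderIso
    rw [exposedSets_deformedVertex hone, ← exposedSets_deformedVertex hρ]
    refine Subset.antisymm (exposedSets_linearMap_comp_subset e.toLinearMap _) ?_
    have := exposedSets_linearMap_comp_subset e.symm.toLinearMap (e ∘ deformedVertex ρ)
    convert this
    funext v
    simp
  · exact (Submodule.finrank_le _).trans (by simp)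

end PPSN

section Nodes

open Polynomial

variable {r : ℕ} {n : Fin r → ℕ}

/-- The indices of the nodes at which a polynomial exposing the face `T` has to vanish. -/
def zeroNodes (s : ℕ) (T : (i : Fin r) → Finset (Fin (n i + 1))) :
    Finset (Σ i, Fin (n i + 1)) :=
  Finset.univ.sigma fun i =>
    if i.val < s then (if T i = Finset.univ then {0} else ∅) else T i

lemma zero_mem_zeroNodes {s : ℕ} {T : (i : Fin r) → Finset (Fin (n i + 1))} {i : Fin r}
    (hi : i.val < s) : (⟨i, 0⟩ : Σ i, Fin (n i + 1)) ∈ zeroNodes s T ↔ T i = Finset.univ := by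
  by_cases h : T i = Finset.univ <;> simp [zeroNodes, hi, h]

lemma mem_zeroNodes {s : ℕ} {T : (i : Fin r) → Finset (Fin (n i + 1))} {i : Fin r}
    (hi : s ≤ i.val) (a : Fin (n i + 1)) :
    (⟨i, a⟩ : Σ i, Fin (n i + 1)) ∈ zeroNodes s T ↔ a ∈ T i := by
  simp [zeroNodes, hi.not_gt]

lemma card_filter_val_lt {s : ℕ} (hs : s ≤ r) :
    (Finset.univ.filter fun i : Fin r => i.val < s).card = s := by
  rw [Fin.card_filter_val_lt, min_eq_right hs]

lemma card_zeroNodes_le {s : ℕ} (hs : s ≤ r) (hseg : ∀ i : Fin r, i.val < s → n i = 1)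
    {T : (i : Fin r) → Finset (Fin (n i + 1))} (hT : ∀ i, (T i).Nonempty) :
    (zeroNodes s T).card ≤ prodDim T + (r - s) := by
  have hrow : ∀ i : Fin r,
      (if i.val < s then (if T i = Finset.univ then {0} else ∅) else T i : Finset _).card ≤
        ((T i).card - 1) + if i.val < s then 0 else 1 := fun i => by
    have := (hT i).card_pos
    split_ifs with hi hu
    · rw [hu, Finset.card_univ, Fintype.card_fin, hseg i hi, Finset.card_singleton]
    · simp
    · omega
  have hcount : ∑ i : Fin r, (if i.val < s then 0 else 1) = r - s := by
    have h1 : ∑ i : Fin r, (if i.val < s then 0 else 1) + ∑ i : Fin r, (if i.val < s then 1 else 0)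
        = r := by
      rw [← Finset.sum_add_distrib]
      trans ∑ i : Fin r, 1
      · exact Finset.sum_congr rfl fun i _ => by split_ifs <;> rfl
      · simp
    have h2 : ∑ i : Fin r, (if i.val < s then 1 else 0) = s := by
      rw [← Finset.card_filter, card_filter_val_lt hs]
    omega
  rw [zeroNodes, Finset.card_sigma]
  refine (Finset.sum_le_sum fun i _ => hrow i).trans_eq ?_
  rw [Finset.sum_add_distrib, hcount, prodDim]

variable {ι : Type*} {τ : ι → ℝ}

lemma natDegree_nodal_sq (Z : Finset ι) : (Lagrange.nodal Z τ ^ 2).natDegree = 2 * Z.card := by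
  rw [natDegree_pow, Lagrange.natDegree_nodal]

lemma eval_nodal_sq_nonneg (Z : Finset ι) (x : ℝ) : 0 ≤ (Lagrange.nodal Z τ ^ 2).eval x := by
  rw [eval_pow]
  positivity

lemma eval_nodal_sq_eq_zero_iff (hτ : Function.Injective τ) (Z : Finset ι) (κ : ι) :
    (Lagrange.nodal Z τ ^ 2).eval (τ κ) = 0 ↔ κ ∈ Z := by
  rw [eval_pow, sq_eq_zero_iff, Lagrange.eval_nodal, Finset.prod_eq_zero_iff]
  refine ⟨fun ⟨i, hi, h⟩ => ?_, fun h => ⟨κ, h, sub_self _⟩⟩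
  rwa [hτ (sub_eq_zero.1 h)]

variable [DecidableEq ι]

lemma eval_div_nodal {K : Finset ι} (hτ : Function.Injective τ) (p : ℝ[X]) {D : ℕ}
    (hD : p.natDegree ≤ D + K.card) {x : ℝ} (hx : (Lagrange.nodal K τ).eval x ≠ 0) :
    p.eval x / (Lagrange.nodal K τ).eval x =
      (p /ₘ Lagrange.nodal K τ).coeff 0 +
      ∑ l : Fin D, (p /ₘ Lagrange.nodal K τ).coeff (l + 1) * x ^ (l.val + 1) +
      ∑ κ ∈ K, p.eval (τ κ) *
        ((Lagrange.basis K τ κ).eval x / (Lagrange.nodal K τ).eval x) := by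
  have hmon := Lagrange.nodal_monic (s := K) (v := τ)
  have hmod : p %ₘ Lagrange.nodal K τ = Lagrange.interpolate K τ fun κ => p.eval (τ κ) := by
    refine Lagrange.eq_interpolate_of_eval_eq _ hτ.injOn ?_ fun κ hκ => ?_
    · rw [← Lagrange.degree_nodal (s := K) (v := τ)]
      exact degree_modByMonic_lt _ hmon
    · conv_rhs => rw [← modByMonic_add_div p (Lagrange.nodal K τ)]
      rw [eval_add, eval_mul, Lagrange.eval_nodal_at_node hκ, zero_mul, add_zero]
  have hquot : (p /ₘ Lagrange.nodal K τ).eval x = (p /ₘ Lagrange.nodal K τ).coeff 0 +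
      ∑ l : Fin D, (p /ₘ Lagrange.nodal K τ).coeff (l + 1) * x ^ (l.val + 1) := by
    have hdeg : (p /ₘ Lagrange.nodal K τ).natDegree < D + 1 := by
      rw [natDegree_divByMonic _ hmon, Lagrange.natDegree_nodal]
      omega
    rw [eval_eq_sum_range' hdeg, Finset.sum_range, Fin.sum_univ_succ]
    simp
  have hsplit : p.eval x = (Lagrange.interpolate K τ fun κ => p.eval (τ κ)).eval x +
      (Lagrange.nodal K τ).eval x * (p /ₘ Lagrange.nodal K τ).eval x := by
    rw [← hmod, ← eval_mul, ← eval_add, modByMonic_add_div]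
  rw [← hquot, hsplit, Lagrange.interpolate_apply, eval_finsetSum, add_div,
    mul_div_cancel_left₀ _ hx, Finset.sum_div, add_comm]
  simp only [eval_mul, eval_C, mul_div_assoc]

end Nodes

section FewSegments

open Polynomial

variable {r : ℕ} {n : Fin r → ℕ}

lemma exists_node_map (t : ℕ) : ∃ τ : (Σ i, Fin (n i + 1)) → ℝ, Function.Injective τ ∧
    ∀ κ, if κ.1.val < t then τ κ < 0 else 0 < τ κ := by
  let e := Fintype.equivFin (Σ i, Fin (n i + 1))
  have hpos : ∀ κ, (0 : ℝ) < (e κ).val + 1 := fun κ => by positivity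
  refine ⟨fun κ => if κ.1.val < t then -((e κ).val + 1) else (e κ).val + 1, fun κ κ' h => ?_,
    fun κ => ?_⟩
  · have h1 := hpos κ
    have h2 := hpos κ'
    apply e.injective
    apply Fin.ext
    have : ((e κ).val : ℝ) = (e κ').val := by
      simp only at h
      split_ifs at h <;> linarith
    exact_mod_cast this
  · by_cases h : κ.1.val < t
    · simp only [h, if_true]
      exact neg_neg_of_pos (hpos κ)
    · simp only [h, if_false]
      exact hpos κ

lemma exists_shift (n : Fin r → ℕ) (t : ℕ) :
    ∃ S : ((i : {i : Fin r // i.val < t}) → Fin (n i) → ℝ) →ₗ[ℝ]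
        ((i : Fin r) → Fin (n i + 1) → ℝ),
      ∀ μ : (i : Fin r) → Fin (n i + 1) → ℝ, ∃ x, ∀ i : Fin r, i.val < t → ∀ a,
        S x i a = μ i 0 - μ i a := by
  refine ⟨LinearMap.pi fun i => if h : i.val < t then LinearMap.pi
    (Fin.cons (α := fun _ => _ →ₗ[ℝ] ℝ) 0 fun b => LinearMap.proj b ∘ₗ LinearMap.proj ⟨i, h⟩)
    else 0, fun μ => ⟨fun i b => μ i 0 - μ i b.succ, fun i hi a => ?_⟩⟩
  cases a using Fin.cases <;> simp [hi]

lemma exists_isPPSN_of_kept {k s t d : ℕ} (hst : s ≤ t) (htr : t ≤ r)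
    (hseg : ∀ i : Fin r, i.val < s → n i = 1)
    (hm : ∑ i with i.val < t, n i ≤ d) (hd : 2 * (k + (r - s)) ≤ d + (t - s)) :
    ∃ P : Set (Fin d → ℝ), IsPPSN k n P ∧ polyDim P ≤ d := by
  obtain ⟨τ, hτ, hsign⟩ := exists_node_map (n := n) t
  obtain ⟨S, hS⟩ := exists_shift n t
  set m := ∑ i with i.val < t, n i with hmdef
  let row : (i : Fin r) → Finset (Fin (n i + 1)) :=
    fun i => if i.val < s then {0} else Finset.univ
  let K : Finset (Σ i, Fin (n i + 1)) := (Finset.univ.filter fun i => i.val < t).sigma row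
  let κ : (i : Fin r) → Fin (n i + 1) → Σ i, Fin (n i + 1) :=
    fun i w => ⟨i, if i.val < s then 0 else w⟩
  let B : (i : Fin r) → Fin (n i + 1) → (j : Fin r) → Fin (n j + 1) → ℝ := fun i w j a =>
    (Lagrange.basis K τ (κ i w)).eval (τ ⟨j, a⟩) / (Lagrange.nodal K τ).eval (τ ⟨j, a⟩)
  have hK : K.card = m + (t - s) := by
    have h1 : ∀ i : Fin r, (row i).card = n i + if i.val < s then 0 else 1 := fun i => by
      by_cases hi : i.val < s <;> simp [row, hi]
      exact (hseg i hi).symm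
    have h2 : ∑ i : Fin r with i.val < t, (if i.val < s then 0 else 1) +
        ∑ i : Fin r with i.val < t, (if i.val < s then 1 else 0) = t := by
      rw [← Finset.sum_add_distrib]
      trans ∑ i : Fin r with i.val < t, 1
      · exact Finset.sum_congr rfl fun i _ => by split_ifs <;> rfl
      · rw [← Finset.card_eq_sum_ones, card_filter_val_lt htr]
    have h3 : ∑ i : Fin r with i.val < t, (if i.val < s then 1 else 0) = s := by
      rw [← Finset.card_filter, Finset.filter_filter]
      refine Eq.trans (congrArg _ ?_) (card_filter_val_lt (hst.trans htr))
      ext i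
      simp only [Finset.mem_filter, Finset.mem_univ, true_and]
      omega
    rw [Finset.card_sigma, Finset.sum_congr rfl fun i _ => h1 i, Finset.sum_add_distrib]
    omega
  have hnodal : ∀ (j : Fin r) (a : Fin (n j + 1)), t ≤ j.val →
      0 < (Lagrange.nodal K τ).eval (τ ⟨j, a⟩) := fun j a hj => by
    rw [Lagrange.eval_nodal]
    refine Finset.prod_pos fun κ' hκ' => ?_
    have h1 := hsign ⟨j, a⟩
    have h2 := hsign κ'
    rw [if_neg hj.not_gt] at h1
    rw [if_pos (by simpa using (Finset.mem_sigma.1 hκ').1)] at h2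
    linarith
  let γ : Fin r → (j : Fin r) → Fin (n j + 1) → ℝ := fun i j a =>
    if i.val < t ∧ t ≤ j.val then -∑ w, B i w j a else 0
  let g : ((Fin (d - m) → ℝ) × ((i : {i : Fin r // i.val < t}) → Fin (n i) → ℝ)) →ₗ[ℝ]
      ((i : Fin r) → Fin (n i + 1) → ℝ) :=
    { toFun := fun c j a => if j.val < t then S c.2 j a else
        ∑ l, c.1 l * τ ⟨j, a⟩ ^ (l.val + 1) + ∑ i with i.val < t, ∑ w, S c.2 i w * B i w j a
      map_add' := fun c c' => by
        funext j a
        by_cases hj : j.val < t <;> simp [hj, add_mul, Finset.sum_add_distrib]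
        ring
      map_smul' := fun x c => by
        funext j a
        by_cases hj : j.val < t <;> simp [hj, mul_assoc, Finset.mul_sum, mul_add] }
  refine exists_isPPSN_of_slack (W := (Fin (d - m) → ℝ) × _) ?_ γ g fun T hT hTk => ?_
  · rw [Module.finrank_prod, Module.finrank_fin_fun, Module.finrank_pi_fintype]
    simp only [Module.finrank_fin_fun]
    have : ∑ i : {i : Fin r // i.val < t}, n i = m := by
      rw [hmdef, ← Finset.sum_subtype_eq_sum_filter]
      simp
    omega
  set Z := zeroNodes s T
  set p := Lagrange.nodal Z τ ^ 2 with hp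
  have hp0 : ∀ x, 0 ≤ p.eval x := eval_nodal_sq_nonneg Z
  have hpZ : ∀ κ', p.eval (τ κ') = 0 ↔ κ' ∈ Z := eval_nodal_sq_eq_zero_iff hτ Z
  have hpdeg : p.natDegree ≤ (d - m) + K.card := by
    have : Z.card ≤ prodDim T + (r - s) := card_zeroNodes_le (hst.trans htr) hseg hT
    rw [natDegree_nodal_sq, hK]
    omega
  let q := p /ₘ Lagrange.nodal K τ
  let μ : (i : Fin r) → Fin (n i + 1) → ℝ := fun i w =>
    if i.val < s then (if w ∈ T i then 0 else p.eval (τ ⟨i, 0⟩)) else p.eval (τ ⟨i, w⟩)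
  have hμ : ∀ i w, 0 ≤ μ i w ∧ (μ i w = 0 ↔ w ∈ T i) := fun i w => by
    by_cases hi : i.val < s
    · by_cases hw : w ∈ T i
      · simp [μ, hi, hw]
      · have : p.eval (τ ⟨i, 0⟩) ≠ 0 := by
          rw [Ne, hpZ, zero_mem_zeroNodes hi]
          exact fun h => hw (h ▸ Finset.mem_univ w)
        simpa [μ, hi, hw, this] using hp0 _
    · have := hpZ ⟨i, w⟩
      rw [mem_zeroNodes (not_lt.1 hi)] at this
      simpa [μ, hi, this] using hp0 _
  have hrow : ∀ (i : Fin r) (f : (Σ i, Fin (n i + 1)) → ℝ),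
      ∑ w ∈ row i, p.eval (τ ⟨i, w⟩) * f ⟨i, w⟩ = ∑ w, μ i w * f (κ i w) := fun i f => by
    by_cases hi : i.val < s
    · simp only [row, μ, κ, hi, if_true, Finset.sum_singleton, ← Finset.sum_mul]
      congr 1
      by_cases hu : T i = Finset.univ
      · simpa [hu] using (hpZ _).2 ((zero_mem_zeroNodes hi).2 hu)
      · have hcard : (T i)ᶜ.card = 1 := by
          have h1 := (hT i).card_pos
          have h2 := (Finset.card_lt_iff_ne_univ _).2 hu
          have h3 := hseg i hi
          rw [Fintype.card_fin] at h2
          rw [Finset.card_compl, Fintype.card_fin]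
          omega
        rw [Finset.sum_ite, Finset.sum_const_zero, zero_add, Finset.sum_const,
          Finset.filter_notMem_eq_sdiff, ← Finset.compl_eq_univ_sdiff, hcard, one_smul]
    · simp [row, μ, κ, hi]
  obtain ⟨x, hx⟩ := hS μ
  refine ⟨(fun l => -q.coeff (l + 1), x), fun i => if i.val < t then μ i 0 else q.coeff 0,
    fun j a => ?_⟩
  by_cases hj : j.val < t
  · have : slack γ (fun i => if i.val < t then μ i 0 else q.coeff 0)
        (g (fun l => -q.coeff (l + 1), x)) j a = μ j a := by
      simp [slack, γ, g, hj, hj.not_ge, hx j hj]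
    rw [this]
    exact hμ j a
  · have hj' := not_lt.1 hj
    have hns : ¬ j.val < s := fun h => hj (h.trans_le hst)
    have hpos := hnodal j a hj'
    have hγ : ∑ i with i < j, (if i.val < t then μ i 0 else q.coeff 0) * γ i j a =
        -∑ i with i.val < t, ∑ w, μ i 0 * B i w j a := by
      rw [← Finset.sum_neg_distrib]
      rw [Finset.sum_filter, Finset.sum_filter]
      refine Finset.sum_congr rfl fun i _ => ?_
      by_cases hi : i.val < t
      · have : i < j := Fin.lt_def.2 (hi.trans_le hj')
        simp [hi, this, γ, hj', Finset.mul_sum]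
      · simp [hi, γ]
    have hS' : ∑ i with i.val < t, ∑ w, S x i w * B i w j a =
        ∑ i with i.val < t, ∑ w, μ i 0 * B i w j a -
          ∑ i with i.val < t, ∑ w, μ i w * B i w j a := by
      rw [← Finset.sum_sub_distrib]
      refine Finset.sum_congr rfl fun i hi => ?_
      rw [← Finset.sum_sub_distrib]
      refine Finset.sum_congr rfl fun w _ => ?_
      rw [hx i (Finset.mem_filter.1 hi).2, sub_mul]
    have hval := eval_div_nodal hτ p hpdeg hpos.ne'
    rw [Finset.sum_sigma, Finset.sum_congr rfl fun i _ => hrow i fun κ' =>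
      (Lagrange.basis K τ κ').eval (τ ⟨j, a⟩) / (Lagrange.nodal K τ).eval (τ ⟨j, a⟩)] at hval
    have : slack γ (fun i => if i.val < t then μ i 0 else q.coeff 0)
        (g (fun l => -q.coeff (l + 1), x)) j a =
          p.eval (τ ⟨j, a⟩) / (Lagrange.nodal K τ).eval (τ ⟨j, a⟩) := by
      rw [hval, slack, hγ]
      simp only [g, LinearMap.coe_mk, AddHom.coe_mk, hj, if_false, hS', neg_mul,
        Finset.sum_neg_distrib]
      simp only [q, B]
      ring
    rw [this, div_eq_zero_iff, or_iff_left hpos.ne', hpZ, mem_zeroNodes (not_lt.1 hns)]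
    exact ⟨div_nonneg (hp0 _) hpos.le, Iff.rfl⟩

end FewSegments

section Perturbation

open Topology

/-- A solution of a surjective linear system survives small perturbations of the system. -/
lemma eventually_exists_solution {V Y : Type*} [NormedAddCommGroup V] [NormedSpace ℝ V]
    [FiniteDimensional ℝ V] [NormedAddCommGroup Y] [NormedSpace ℝ Y] [FiniteDimensional ℝ Y]
    (L E : V →ₗ[ℝ] Y) (hL : Function.Surjective L) {x₀ : V} (hx₀ : L x₀ = 0) {U : Set V}
    (hU : U ∈ 𝓝 x₀) : ∀ᶠ ε in 𝓝 (0 : ℝ), ∃ x ∈ U, L x = ε • E x := by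
  have : CompleteSpace V := FiniteDimensional.complete ℝ V
  have : CompleteSpace Y := FiniteDimensional.complete ℝ Y
  let L' := L.toContinuousLinearMap
  let E' := E.toContinuousLinearMap
  let F : V × ℝ → Y × ℝ := fun z => (L' z.1 - z.2 • E' z.1, z.2)
  have h1 : HasStrictFDerivAt (fun z : V × ℝ => L' z.1)
      (L' ∘L ContinuousLinearMap.fst ℝ V ℝ) (x₀, 0) :=
    L'.hasStrictFDerivAt.comp (x₀, (0 : ℝ)) hasStrictFDerivAt_fst
  have h2 : HasStrictFDerivAt (fun z : V × ℝ => E' z.1)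
      (E' ∘L ContinuousLinearMap.fst ℝ V ℝ) (x₀, 0) :=
    E'.hasStrictFDerivAt.comp (x₀, (0 : ℝ)) hasStrictFDerivAt_fst
  have h3 : HasStrictFDerivAt (fun z : V × ℝ => z.2) (ContinuousLinearMap.snd ℝ V ℝ) (x₀, 0) :=
    hasStrictFDerivAt_snd
  have hF : HasStrictFDerivAt F _ (x₀, 0) := (h1.sub (h3.smul h2)).prodMk h3
  have hmap := hF.map_nhds_eq_of_surj (by
    rw [LinearMap.range_eq_top]
    rintro ⟨y, δ⟩
    obtain ⟨v, hv⟩ := hL (y + δ • E x₀)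
    refine ⟨(v, δ), ?_⟩
    simp [L', E', hv])
  have hF0 : F (x₀, 0) = (0, 0) := by simp [F, L', hx₀]
  have hmem : F '' (U ×ˢ univ) ∈ 𝓝 ((0 : Y), (0 : ℝ)) := by
    have := Filter.image_mem_map (m := F)
      (prod_mem_nhds hU Filter.univ_mem : U ×ˢ univ ∈ 𝓝 (x₀, (0 : ℝ)))
    rwa [hmap, hF0] at this
  have hcont : Filter.Tendsto (fun ε : ℝ => ((0 : Y), ε)) (𝓝 0) (𝓝 (0, 0)) :=
    (Continuous.prodMk_right (0 : Y)).tendsto 0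
  filter_upwards [hcont hmem] with ε hε
  obtain ⟨⟨x, δ⟩, ⟨hxU, -⟩, hxε⟩ := hε
  obtain ⟨hx1, rfl⟩ := Prod.ext_iff.1 hxε
  exact ⟨x, hxU, sub_eq_zero.1 hx1⟩

end Perturbation

section ManySegments

open Polynomial

variable {r : ℕ} {n : Fin r → ℕ}

/-- The `d` indices preceding `e`. -/
def window (d : ℕ) (e : Fin r) : Finset (Fin r) :=
  Finset.univ.filter fun i => e.val ≤ i.val + d ∧ i < e

lemma card_window {d : ℕ} {e : Fin r} (he : d ≤ e.val) : (window d e).card = d := by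
  have : (window d e).map Fin.valEmbedding = Finset.Ico (e.val - d) e.val := by
    ext i
    simp only [window, Finset.mem_map, Finset.mem_filter, Finset.mem_univ, true_and,
      Fin.valEmbedding_apply, Finset.mem_Ico, Fin.lt_def]
    refine ⟨?_, fun h => ⟨⟨i, h.2.trans e.2⟩, ?_, rfl⟩⟩
    · rintro ⟨i, h, rfl⟩
      omega
    · simp only
      omega
  rw [← Finset.card_map, this, Nat.card_Ico]
  omega

/-- The divided difference of the values on the `d` nodes preceding the `e`-th one. -/
noncomputable def windowDiff (d : ℕ) (x : Fin r → ℝ) (e : Fin r) : (Fin r → ℝ) →ₗ[ℝ] ℝ :=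
  lcoeff ℝ (d - 1) ∘ₗ Lagrange.interpolate (window d e) x

lemma windowDiff_apply (d : ℕ) (x : Fin r → ℝ) (e : Fin r) (M : Fin r → ℝ) :
    windowDiff d x e M =
      ∑ i ∈ window d e, M i * (Lagrange.basis (window d e) x i).coeff (d - 1) := by
  simp [windowDiff, Lagrange.interpolate_apply]

lemma windowDiff_eval {d : ℕ} {x : Fin r → ℝ} (hx : Function.Injective x) {e : Fin r}
    (he : d ≤ e.val) {f : ℝ[X]} (hf : f.degree < (d - 1 : ℕ)) :
    windowDiff d x e (fun i => f.eval (x i)) = 0 := by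
  rw [windowDiff, LinearMap.comp_apply, ← Lagrange.eq_interpolate hx.injOn, lcoeff_apply]
  · exact coeff_eq_zero_of_degree_lt hf
  · rw [card_window he]
    exact hf.trans_le (by exact_mod_cast Nat.sub_le d 1)

lemma exists_windowDiff_eq {d : ℕ} (hd : 1 ≤ d) {x : Fin r → ℝ} (hx : Function.Injective x)
    (u : Fin r → ℝ) : ∃ M, ∀ e : Fin r, d ≤ e.val → windowDiff d x e M = u e := by
  let b : Fin r → Fin r → ℝ := fun e i => (Lagrange.basis (window d e) x i).coeff (d - 1)
  obtain ⟨M, hM⟩ := exists_fixed_of_wellFounded (wellFounded_lt (α := Fin r))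
    (fun i M => if h : i.val + 1 < r then
      (u ⟨i + 1, h⟩ - ∑ i' ∈ (window d ⟨i + 1, h⟩).erase i, M i' * b ⟨i + 1, h⟩ i') /
        b ⟨i + 1, h⟩ i else 0) fun i M M' hMM' => by
      split_ifs with h
      · congr 2
        refine Finset.sum_congr rfl fun i' hi' => ?_
        rw [hMM' i']
        simp only [window, Finset.mem_erase, Finset.mem_filter, Fin.lt_def, Fin.ext_iff, ne_eq]
          at hi' ⊢
        omega
      · rfl
  refine ⟨M, fun e he => ?_⟩
  have hei : e.val - 1 + 1 = e.val := by omega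
  have hi : (⟨e.val - 1, by omega⟩ : Fin r) ∈ window d e := by
    simp only [window, Finset.mem_filter, Finset.mem_univ, true_and, Fin.lt_def]
    omega
  set i : Fin r := ⟨e.val - 1, by omega⟩
  have hb : b e i ≠ 0 := by
    have := Lagrange.natDegree_basis hx.injOn hi
    rw [card_window he] at this
    change (Lagrange.basis (window d e) x i).coeff (d - 1) ≠ 0
    rw [← this]
    exact leadingCoeff_ne_zero.2 (Lagrange.basis_ne_zero hx.injOn hi)
  have hMi := hM i
  simp only [i, hei, e.2, dif_pos, Fin.eta] at hMi
  rw [windowDiff_apply, ← Finset.add_sum_erase _ _ hi]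
  change M i * b e i + ∑ i' ∈ (window d e).erase i, M i' * b e i' = u e
  rw [show M i = _ from hMi, div_mul_cancel₀ _ hb]
  ring

lemma injective_zero_node {τ : (Σ i, Fin (n i + 1)) → ℝ} (hτ : Function.Injective τ) :
    Function.Injective fun i : Fin r => τ ⟨i, 0⟩ := fun _ _ h => congrArg Sigma.fst (hτ h)

/-- The value at the node `κ` of the polynomial interpolating at the first `d` segments; for a
later segment, the value prescribed there. -/
noncomputable def nodeValue (d s : ℕ) (τ : (Σ i, Fin (n i + 1)) → ℝ) (κ : Σ i, Fin (n i + 1)) :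
    (Fin r → ℝ) →ₗ[ℝ] ℝ :=
  if d ≤ κ.1.val ∧ κ.1.val < s then LinearMap.proj κ.1 else
    leval (τ κ) ∘ₗ Lagrange.interpolate {i : Fin r | i.val < d} fun i => τ ⟨i, 0⟩

lemma nodeValue_zero {d s : ℕ} {τ : (Σ i, Fin (n i + 1)) → ℝ} (hτ : Function.Injective τ)
    {i : Fin r} (hi : i.val < s) (M : Fin r → ℝ) : nodeValue d s τ ⟨i, 0⟩ M = M i := by
  have hx := injective_zero_node hτ
  rw [nodeValue]
  split_ifs with h
  · rfl
  · exact Lagrange.eval_interpolate_at_node _ hx.injOn (by simpa using by_contra fun hd => h ⟨not_lt.1 hd, hi⟩)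

lemma nodeValue_of_le {d s : ℕ} (τ : (Σ i, Fin (n i + 1)) → ℝ) {κ : Σ i, Fin (n i + 1)}
    (hκ : s ≤ κ.1.val) (M : Fin r → ℝ) : nodeValue d s τ κ M =
      ∑ i : Fin r with i.val < d, M i *
        (Lagrange.basis {i : Fin r | i.val < d} (fun i => τ ⟨i, 0⟩) i).eval (τ κ) := by
  rw [nodeValue, if_neg (by omega)]
  simp [Lagrange.interpolate_apply]

lemma nodeValue_eval {d s : ℕ} (hdr : d ≤ r) {τ : (Σ i, Fin (n i + 1)) → ℝ}
    (hτ : Function.Injective τ) {f : ℝ[X]} (hf : f.degree < d) {κ : Σ i, Fin (n i + 1)}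
    (hκ : κ.1.val < s → κ.2 = 0) :
    nodeValue d s τ κ (fun i => f.eval (τ ⟨i, 0⟩)) = f.eval (τ κ) := by
  have hx := injective_zero_node hτ
  rw [nodeValue]
  split_ifs with h
  · obtain ⟨i, a⟩ := κ
    simp only at hκ h
    rw [hκ h.2]
    rfl
  · rw [LinearMap.comp_apply, ← Lagrange.eq_interpolate hx.injOn, leval_apply]
    rwa [card_filter_val_lt hdr]

lemma fst_lt_of_mem_zeroNodes {s : ℕ} {T : (i : Fin r) → Finset (Fin (n i + 1))}
    {κ : Σ i, Fin (n i + 1)} (hκ : κ ∈ zeroNodes s T) (h : κ.1.val < s) : κ.2 = 0 := by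
  obtain ⟨i, a⟩ := κ
  simp only [zeroNodes, Finset.mem_sigma, Finset.mem_univ, true_and, if_pos h] at hκ
  split_ifs at hκ
  · simpa using hκ
  · simp at hκ

lemma eventually_exists_nodeValue {k s d : ℕ} (hsr : s ≤ r)
    (hseg : ∀ i : Fin r, i.val < s → n i = 1) (hds : d ≤ s) (hd : 2 * (k + (r - s)) + 2 ≤ d)
    {τ : (Σ i, Fin (n i + 1)) → ℝ} (hτ : Function.Injective τ)
    {T : (i : Fin r) → Finset (Fin (n i + 1))} (hT : ∀ i, (T i).Nonempty) (hTk : prodDim T ≤ k)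
    (σ : Fin r → ℝ) :
    ∀ᶠ ε in nhds (0 : ℝ), ∃ M : Fin r → ℝ,
      (∀ e : Fin r, d ≤ e.val → windowDiff d (fun i => τ ⟨i, 0⟩) e M = ε * (σ e * M e)) ∧
      (∀ κ : Σ i, Fin (n i + 1), (κ.1.val < s → κ.2 = 0) →
        0 ≤ nodeValue d s τ κ M ∧ (nodeValue d s τ κ M = 0 ↔ κ ∈ zeroNodes s T)) := by
  set Z := zeroNodes s T
  have hx := injective_zero_node hτ
  have hdr := hds.trans hsr
  have hZ : Z.card ≤ k + (r - s) := by
    have : Z.card ≤ prodDim T + (r - s) := card_zeroNodes_le hsr hseg hT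
    omega
  have hZ0 : ∀ κ ∈ Z, κ.1.val < s → κ.2 = 0 := fun κ hκ => fst_lt_of_mem_zeroNodes hκ
  let L : (Fin r → ℝ) →ₗ[ℝ] ({e : Fin r // d ≤ e.val} → ℝ) × (Z → ℝ) :=
    (LinearMap.pi fun e => windowDiff d (fun i => τ ⟨i, 0⟩) e.1).prod
      (LinearMap.pi fun κ => nodeValue d s τ κ.1)
  let E : (Fin r → ℝ) →ₗ[ℝ] ({e : Fin r // d ≤ e.val} → ℝ) × (Z → ℝ) :=
    (LinearMap.pi fun e => σ e.1 • LinearMap.proj e.1).prod 0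
  have hL : Function.Surjective L := by
    rintro ⟨u, w⟩
    obtain ⟨M, hM⟩ := exists_windowDiff_eq (d := d) (by omega) hx
      fun e => if h : d ≤ e.val then u ⟨e, h⟩ else 0
    let f := Lagrange.interpolate Z τ fun κ =>
      if h : κ ∈ Z then w ⟨κ, h⟩ - nodeValue d s τ κ M else 0
    have hf : f.degree < (d - 1 : ℕ) := by
      refine (Lagrange.degree_interpolate_lt _ hτ.injOn).trans_le ?_
      exact_mod_cast (by omega : Z.card ≤ d - 1)
    refine ⟨M + fun i => f.eval (τ ⟨i, 0⟩), Prod.ext (funext fun e => ?_) (funext fun κ => ?_)⟩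
    · change windowDiff d (fun i => τ ⟨i, 0⟩) e.1 (M + fun i => f.eval (τ ⟨i, 0⟩)) = u e
      rw [map_add, windowDiff_eval hx e.2 hf, hM e.1 e.2, dif_pos e.2, add_zero]
    · change nodeValue d s τ κ.1 (M + fun i => f.eval (τ ⟨i, 0⟩)) = w κ
      rw [map_add, nodeValue_eval hdr hτ (hf.trans_le (by exact_mod_cast Nat.sub_le d 1)) (hZ0 κ κ.2),
        Lagrange.eval_interpolate_at_node _ hτ.injOn κ.2, dif_pos κ.2]
      ring
  set p := Lagrange.nodal Z τ ^ 2 with hp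
  have hpZ : ∀ κ', p.eval (τ κ') = 0 ↔ κ' ∈ Z := eval_nodal_sq_eq_zero_iff hτ Z
  have hpdeg : p.degree < (d - 1 : ℕ) := by
    refine degree_le_natDegree.trans_lt ?_
    rw [natDegree_nodal_sq]
    exact_mod_cast (by omega : 2 * Z.card < d - 1)
  have hpval : ∀ κ : Σ i, Fin (n i + 1), (κ.1.val < s → κ.2 = 0) →
      nodeValue d s τ κ (fun i => p.eval (τ ⟨i, 0⟩)) = p.eval (τ κ) := fun κ hκ =>
    nodeValue_eval hdr hτ (hpdeg.trans_le (by exact_mod_cast Nat.sub_le d 1)) hκ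
  have hL0 : L (fun i => p.eval (τ ⟨i, 0⟩)) = 0 := by
    refine Prod.ext (funext fun e => windowDiff_eval hx e.2 hpdeg) (funext fun κ => ?_)
    exact (hpval κ (hZ0 κ κ.2)).trans ((hpZ κ).2 κ.2)
  have hU : ∀ᶠ M in nhds fun i : Fin r => p.eval (τ ⟨i, 0⟩),
      ∀ κ : Σ i, Fin (n i + 1), (κ.1.val < s → κ.2 = 0) → κ ∉ Z → 0 < nodeValue d s τ κ M := by
    refine Filter.eventually_all.2 fun κ => ?_
    by_cases hκ : (κ.1.val < s → κ.2 = 0) ∧ κ ∉ Z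
    · have hpos : 0 < nodeValue d s τ κ fun i : Fin r => p.eval (τ ⟨i, 0⟩) := by
        rw [hpval κ hκ.1]
        exact lt_of_le_of_ne (eval_nodal_sq_nonneg Z _) (Ne.symm (mt (hpZ κ).1 hκ.2))
      filter_upwards [(nodeValue d s τ κ).continuous_of_finiteDimensional.continuousAt.eventually
        (lt_mem_nhds hpos)] with M hM _ _ using hM
    · exact Filter.Eventually.of_forall fun M h1 h2 => absurd ⟨h1, h2⟩ hκ
  filter_upwards [eventually_exists_solution L E hL hL0 hU] with ε ⟨M, hMpos, hM⟩
  obtain ⟨hM1, hM2⟩ := Prod.ext_iff.1 hM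
  refine ⟨M, fun e he => ?_, fun κ hκ => ?_⟩
  · exact congrFun hM1 ⟨e, he⟩
  · by_cases h : κ ∈ Z
    · have : nodeValue d s τ κ M = 0 :=
        (congrFun hM2 ⟨κ, h⟩).trans (mul_zero ε)
      simp [this, h]
    · have := hMpos κ hκ h
      exact ⟨this.le, fun h0 => absurd h0 this.ne', fun h' => absurd h' h⟩

end ManySegments

section ManySegmentsPPSN

open Polynomial

variable {r : ℕ} {n : Fin r → ℕ}

/-- The slack of a segment, in terms of the value `y` at its node. -/
lemma segment_slack {m : ℕ} (hm : m = 1) {T : Finset (Fin (m + 1))} (hT : T.Nonempty) {y : ℝ}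
    (hy : 0 ≤ y) (hyT : y = 0 ↔ T = Finset.univ) (a : Fin (m + 1)) :
    0 ≤ y - (if a = 0 then 1 else -1) * ((if 0 ∈ T then 1 else -1) * y) ∧
      (y - (if a = 0 then 1 else -1) * ((if 0 ∈ T then 1 else -1) * y) = 0 ↔ a ∈ T) := by
  subst hm
  have hmem : T = Finset.univ ↔ 0 ∈ T ∧ 1 ∈ T := by
    refine ⟨fun h => by simp [h], fun h => Finset.eq_univ_of_forall fun b => ?_⟩
    fin_cases b
    exacts [h.1, h.2]
  have hne : 0 ∈ T ∨ 1 ∈ T := by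
    obtain ⟨b, hb⟩ := hT
    fin_cases b
    exacts [Or.inl hb, Or.inr hb]
  rw [hmem] at hyT
  fin_cases a <;> by_cases h0 : 0 ∈ T <;> by_cases h1 : 1 ∈ T <;>
    simp_all [← two_mul]

lemma exists_isPPSN_of_truncated {k s d : ℕ} (hsr : s ≤ r)
    (hseg : ∀ i : Fin r, i.val < s → n i = 1) (hds : d ≤ s) (hd : 2 * (k + (r - s)) + 2 ≤ d) :
    ∃ P : Set (Fin d → ℝ), IsPPSN k n P ∧ polyDim P ≤ d := by
  obtain ⟨τ, hτ, -⟩ := exists_node_map (n := n) 0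
  let x : Fin r → ℝ := fun i => τ ⟨i, 0⟩
  let σ : ((i : Fin r) → Finset (Fin (n i + 1))) → Fin r → ℝ :=
    fun T i => if 0 ∈ T i then 1 else -1
  have hall : ∀ᶠ ε in nhds (0 : ℝ), ∀ T : (i : Fin r) → Finset (Fin (n i + 1)),
      (∀ i, (T i).Nonempty) → prodDim T ≤ k → ∃ M : Fin r → ℝ,
      (∀ e : Fin r, d ≤ e.val → windowDiff d x e M = ε * (σ T e * M e)) ∧
      (∀ κ : Σ i, Fin (n i + 1), (κ.1.val < s → κ.2 = 0) →
        0 ≤ nodeValue d s τ κ M ∧ (nodeValue d s τ κ M = 0 ↔ κ ∈ zeroNodes s T)) := by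
    refine Filter.eventually_all.2 fun T => ?_
    by_cases hT : (∀ i, (T i).Nonempty) ∧ prodDim T ≤ k
    · filter_upwards [eventually_exists_nodeValue hsr hseg hds hd hτ hT.1 hT.2 (σ T)] with ε h _ _
        using h
    · exact Filter.Eventually.of_forall fun ε h1 h2 => absurd ⟨h1, h2⟩ hT
  obtain ⟨ε, hε, hε0⟩ := ((hall.filter_mono nhdsWithin_le_nhds).and
    (self_mem_nhdsWithin : {(0 : ℝ)}ᶜ ∈ nhdsWithin 0 {0}ᶜ)).exists
  let γ : Fin r → (j : Fin r) → Fin (n j + 1) → ℝ := fun i j a =>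
    if s ≤ j.val then
      if i.val < d then -(Lagrange.basis {i : Fin r | i.val < d} x i).eval (τ ⟨j, a⟩) else 0
    else if d ≤ j.val ∧ i ∈ window d j then
      (if a = 0 then 1 else -1) * ((Lagrange.basis (window d j) x i).coeff (d - 1) / ε)
    else 0
  let g : (Fin d → ℝ) →ₗ[ℝ] ((i : Fin r) → Fin (n i + 1) → ℝ) :=
    LinearMap.pi fun i => LinearMap.pi fun a => if h : i.val < d then
      (if a = 0 then 1 else -1 : ℝ) • LinearMap.proj ⟨i.val, h⟩ else 0
  refine exists_isPPSN_of_slack (by simp) γ g fun T hT hTk => ?_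
  obtain ⟨M, hM, hval⟩ := hε T hT hTk
  have hseg_val : ∀ i : Fin r, i.val < s → 0 ≤ M i ∧ (M i = 0 ↔ T i = Finset.univ) := fun i hi => by
    have := hval ⟨i, 0⟩ fun _ => rfl
    rwa [nodeValue_zero hτ hi, zero_mem_zeroNodes hi] at this
  refine ⟨fun l => σ T ⟨l, by omega⟩ * M ⟨l, by omega⟩, fun i => if i.val < s then M i else 0,
    fun j a => ?_⟩
  by_cases hjs : j.val < s
  · have : slack γ (fun i => if i.val < s then M i else 0)
        (g fun l => σ T ⟨l, by omega⟩ * M ⟨l, by omega⟩) j a =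
          M j - (if a = 0 then 1 else -1) * (σ T j * M j) := by
      by_cases hjd : j.val < d
      · by_cases ha : a = 0 <;> simp [slack, γ, g, hjs, hjd, hjs.not_ge, hjd.not_ge, ha]
      · have hsum : ∑ i with i < j, (if i.val < s then M i else 0) * γ i j a =
            (if a = 0 then 1 else -1) * (windowDiff d x j M / ε) := by
          rw [windowDiff_apply, Finset.sum_div, Finset.mul_sum, window, Finset.sum_filter,
            Finset.sum_filter]
          refine Finset.sum_congr rfl fun i _ => ?_
          by_cases hij : i < j
          · have his : i.val < s := (Fin.lt_def.1 hij).trans hjs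
            by_cases hw : j.val ≤ i.val + d
            · simp [γ, hij, his, hjs.not_ge, not_lt.1 hjd, window, hw]
              split_ifs <;> ring
            · simp [γ, hjs.not_ge, window, hw]
          · simp [hij]
        rw [slack, hsum, hM j (not_lt.1 hjd), mul_div_cancel_left₀ _ hε0]
        simp [g, hjs, hjd]
    rw [this]
    exact segment_slack (hseg j hjs) (hT j) (hseg_val j hjs).1 (hseg_val j hjs).2 a
  · have hjs' := not_lt.1 hjs
    have : slack γ (fun i => if i.val < s then M i else 0)
        (g fun l => σ T ⟨l, by omega⟩ * M ⟨l, by omega⟩) j a = nodeValue d s τ ⟨j, a⟩ M := by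
      have hjd : ¬ j.val < d := fun h => hjs (h.trans_le hds)
      rw [nodeValue_of_le τ hjs', slack]
      simp only [g, LinearMap.pi_apply, hjd, dif_neg, not_false_eq_true, LinearMap.zero_apply,
        hjs, if_false, sub_zero, zero_sub]
      rw [← Finset.sum_neg_distrib, Finset.sum_filter, Finset.sum_filter]
      refine Finset.sum_congr rfl fun i _ => ?_
      by_cases hi : i.val < d
      · have h1 : i < j := Fin.lt_def.2 (hi.trans_le (hds.trans hjs'))
        simp [hi, h1, hi.trans_le hds, γ, hjs', x]
      · simp [hi, γ, hjs']
    rw [this, ← mem_zeroNodes hjs']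
    exact hval ⟨j, a⟩ fun h => absurd h hjs

end ManySegmentsPPSN

/-- Theorem `defp-ppsn`. With `n_1 = ⋯ = n_s = 1 < n_{s+1} ≤ ⋯ ≤ n_r`
and `t ∈ {s,…,r}` maximal such that `3s + Σ_{i=s+1}^t (n_i + 1) ≤ 2k + 2r`, there is a
`(k,n̄)`-PPSN polytope of dimension at most `2(k+r)-s-t` if `3s ≤ 2k+2r`, at most
`2(k+r-s)+1` if `3s = 2k+2r+1`, and at most `2(k+r-s+1)` if `3s ≥ 2k+2r+2`. -/
theorem statement10 (k r s : ℕ) (hr : 1 ≤ r) (hs : s ≤ r) (n : Fin r → ℕ)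
    (hseg : ∀ i : Fin r, i.val < s → n i = 1)
    (hbig : ∀ i : Fin r, s ≤ i.val → 2 ≤ n i)
    (hmono : ∀ i j : Fin r, i ≤ j → n i ≤ n j) :
    ((3 * s ≤ 2 * k + 2 * r) →
      ∀ t : ℕ, s ≤ t → t ≤ r →
        (3 * s + ∑ i ∈ Finset.univ.filter (fun i : Fin r => s ≤ i.val ∧ i.val < t), (n i + 1)
          ≤ 2 * k + 2 * r) →
        (∀ t' : ℕ, s ≤ t' → t' ≤ r →
          (3 * s + ∑ i ∈ Finset.univ.filter (fun i : Fin r => s ≤ i.val ∧ i.val < t'),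
              (n i + 1) ≤ 2 * k + 2 * r) → t' ≤ t) →
        ∃ P : Set (Fin (2 * (k + r) - s - t) → ℝ),
          IsPPSN k n P ∧ polyDim P ≤ 2 * (k + r) - s - t) ∧
    ((3 * s = 2 * k + 2 * r + 1) →
      ∃ P : Set (Fin (2 * (k + r - s) + 1) → ℝ),
        IsPPSN k n P ∧ polyDim P ≤ 2 * (k + r - s) + 1) ∧
    ((2 * k + 2 * r + 2 ≤ 3 * s) →
      ∃ P : Set (Fin (2 * (k + r - s + 1)) → ℝ),
        IsPPSN k n P ∧ polyDim P ≤ 2 * (k + r - s + 1)) := by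
  have hsum : ∑ i : Fin r with i.val < s, n i = s := by
    rw [Finset.sum_congr rfl fun i hi => hseg i (Finset.mem_filter.1 hi).2,
      ← Finset.card_eq_sum_ones, card_filter_val_lt hs]
  refine ⟨fun _ t hst htr ht _ => ?_, fun h => ?_, fun h => ?_⟩
  · have hsplit : ∀ f : Fin r → ℕ, ∑ i with i.val < t, f i = ∑ i with i.val < s, f i +
        ∑ i ∈ Finset.univ.filter (fun i : Fin r => s ≤ i.val ∧ i.val < t), f i := fun f => by
      rw [← Finset.sum_filter_add_sum_filter_not _ fun i : Fin r => i.val < s,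
        Finset.filter_filter, Finset.filter_filter]
      congr 1 <;> refine Finset.sum_congr (Finset.filter_congr fun i _ => ?_) fun _ _ => rfl <;>
        omega
    have h1 := hsplit n
    have h2 := hsplit 1
    simp only [Pi.one_apply, ← Finset.card_eq_sum_ones] at h2
    rw [card_filter_val_lt htr, card_filter_val_lt hs] at h2
    rw [Finset.sum_add_distrib, ← Finset.card_eq_sum_ones] at ht
    exact exists_isPPSN_of_kept hst htr hseg (by omega) (by omega)
  · exact exists_isPPSN_of_kept le_rfl hs hseg (by omega) (by omega)
  · exact exists_isPPSN_of_truncated hs hseg (by omega) (by omega)
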